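/- Let Γ be an infinite finitely generated group and let μ be a finitely supported symmetric admissible probability measure on Γ whose random walk is transient at the spectral radius. For 1 ≤ r < R, the function 𝔡_r(x,y) := ω_Γ(r)·|x⁻¹y| + |x⁻¹y|_r is a proper metric on Γ (balls of finite radius are finite sets) that is quasi-isometric to the word metric: there exist L ≥ 1 and C ≥ 0 such that L^{−1}|x⁻¹y| − C ≤ 𝔡_r(x,y) ≤ L|x⁻¹y| + C for all x, y ∈ Γ. -/

import Mathlib

open scoped Pointwise Classical
open Filter

namespace GreenGrowth

variable {G : Type*} [Group G]

/-- Word length with respect to a finite generating set `S` (symmetrized). -/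
noncomputable def wordLength (S : Finset G) (x : G) : ℕ :=
  sInf {n : ℕ | x ∈ ((S : Set G) ∪ (S : Set G)⁻¹) ^ n}

/-- `n`-step distribution of the `μ`-random walk: the `n`-fold convolution power of `μ`,
so that `p_n(x, y) = convPow μ n (x⁻¹ * y)`. -/
noncomputable def convPow (μ : G → ℝ) : ℕ → G → ℝ
  | 0 => fun x => if x = 1 then 1 else 0
  | n + 1 => fun x => ∑' y : G, μ y * convPow μ n (y⁻¹ * x)

/-- The Green function `G(e, x | r)`. -/
noncomputable def green (μ : G → ℝ) (r : ℝ) (x : G) : ℝ :=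
  ∑' n : ℕ, r ^ n * convPow μ n x

/-- `μ` is a probability measure on `G`. -/
def IsProbMeasure (μ : G → ℝ) : Prop := (∀ x, 0 ≤ μ x) ∧ HasSum μ 1

/-- `μ` is admissible: its support generates `G` as a semigroup, i.e. every element of `G`
is reached with positive probability at some time. -/
def IsAdmissible (μ : G → ℝ) : Prop := ∀ x : G, ∃ n : ℕ, 0 < convPow μ n x

/-- `μ` is symmetric. -/
def IsSymm (μ : G → ℝ) : Prop := ∀ x : G, μ x⁻¹ = μ x

/-- The spectral radius of the `μ`-random walk. -/
noncomputable def spectralRadius (μ : G → ℝ) : ℝ :=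
  limsup (fun n : ℕ => (convPow μ n 1) ^ ((n : ℝ)⁻¹)) atTop

/-- `R`, the radius of convergence of the Green function: the inverse of the
spectral radius. -/
noncomputable def greenRadius (μ : G → ℝ) : ℝ := (spectralRadius μ)⁻¹

/-- The `μ`-random walk is transient at the spectral radius: the Green function
`G(x, y | r)` is finite for all `x, y` and all `0 < r ≤ R`. -/
def TransientAtSpectralRadius (μ : G → ℝ) : Prop :=
  ∀ r : ℝ, 0 < r → r ≤ greenRadius μ →
    ∀ x : G, Summable (fun n : ℕ => r ^ n * convPow μ n x)

/-- `H_r(n) = Σ_{x ∈ S_n} G(e, x | r)`, the sum of the Green function over the sphere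
of radius `n`. -/
noncomputable def greenSphereSum (S : Finset G) (μ : G → ℝ) (r : ℝ) (n : ℕ) : ℝ :=
  ∑' x : G, if wordLength S x = n then green μ r x else 0

/-- `ω_Γ(r) = limsup (1/n) log H_r(n)`, the growth rate of the Green function. -/
noncomputable def greenGrowthRate (S : Finset G) (μ : G → ℝ) (r : ℝ) : ℝ :=
  limsup (fun n : ℕ => Real.log (greenSphereSum S μ r n) / n) atTop

/-- The cardinality of the sphere of radius `n`. -/
noncomputable def sphereCard (S : Finset G) (n : ℕ) : ℕ :=
  Nat.card {x : G // wordLength S x = n}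

/-- The volume growth rate `v = limsup (1/n) log #S_n`. -/
noncomputable def volumeGrowthRate (S : Finset G) : ℝ :=
  limsup (fun n : ℕ => Real.log (sphereCard S n) / n) atTop

end GreenGrowth

namespace GreenGrowth

variable {G : Type*} [Group G]

/-- The `r`-Green metric `|g|_r = −log(G(e,g|r)/G(e,e|r))`. -/
noncomputable def greenNorm (μ : G → ℝ) (r : ℝ) (g : G) : ℝ :=
  -Real.log (green μ r g / green μ r 1)

/-- The distance `𝔡_r(x,y) = ω_Γ(r)|x⁻¹y| + |x⁻¹y|_r`. -/
noncomputable def drDist (S : Finset G) (μ : G → ℝ) (r : ℝ) (x y : G) : ℝ :=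
  greenGrowthRate S μ r * (wordLength S (x⁻¹ * y) : ℝ) + greenNorm μ r (x⁻¹ * y)

end GreenGrowth

namespace GreenGrowth

variable {G : Type*} [Group G]

section WordLength

variable {S : Finset G}

theorem exists_mem_pow (hS : Subgroup.closure (S : Set G) = ⊤) (x : G) :
    ∃ n : ℕ, x ∈ ((S : Set G) ∪ (S : Set G)⁻¹) ^ n := by
  have hx : x ∈ Submonoid.closure ((S : Set G) ∪ (S : Set G)⁻¹) := by
    rw [← Subgroup.closure_toSubmonoid, hS]
    trivial
  induction hx using Submonoid.closure_induction with
  | mem x hx => exact ⟨1, by simpa using hx⟩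
  | one => exact ⟨0, by simp⟩
  | mul x y _ _ hx hy =>
    obtain ⟨m, hm⟩ := hx
    obtain ⟨n, hn⟩ := hy
    exact ⟨m + n, by rw [pow_add]; exact Set.mul_mem_mul hm hn⟩

theorem mem_pow_wordLength (hS : Subgroup.closure (S : Set G) = ⊤) (x : G) :
    x ∈ ((S : Set G) ∪ (S : Set G)⁻¹) ^ wordLength S x :=
  Nat.sInf_mem (exists_mem_pow hS x)

theorem wordLength_le_of_mem_pow {x : G} {n : ℕ}
    (hx : x ∈ ((S : Set G) ∪ (S : Set G)⁻¹) ^ n) : wordLength S x ≤ n :=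
  Nat.sInf_le hx

theorem wordLength_one : wordLength S (1 : G) = 0 :=
  Nat.le_zero.mp (wordLength_le_of_mem_pow (by simp))

theorem wordLength_eq_zero_iff (hS : Subgroup.closure (S : Set G) = ⊤) {x : G} :
    wordLength S x = 0 ↔ x = 1 := by
  refine ⟨fun h => ?_, fun h => h ▸ wordLength_one⟩
  have hx := mem_pow_wordLength hS x
  rw [h] at hx
  simpa using hx

theorem wordLength_mul_le (hS : Subgroup.closure (S : Set G) = ⊤) (x y : G) :
    wordLength S (x * y) ≤ wordLength S x + wordLength S y := by
  apply wordLength_le_of_mem_pow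
  rw [pow_add]
  exact Set.mul_mem_mul (mem_pow_wordLength hS x) (mem_pow_wordLength hS y)

theorem wordLength_inv (hS : Subgroup.closure (S : Set G) = ⊤) (x : G) :
    wordLength S x⁻¹ = wordLength S x := by
  have key : ∀ y : G, wordLength S y⁻¹ ≤ wordLength S y := fun y => by
    apply wordLength_le_of_mem_pow
    have h := mem_pow_wordLength hS y
    rw [← Set.mem_inv, ← inv_pow, Set.union_inv, inv_inv, Set.union_comm]
    exact h
  exact le_antisymm (key x) (by simpa using key x⁻¹)

theorem finite_pow_of_finite {T : Set G} (hT : T.Finite) (n : ℕ) : (T ^ n).Finite := by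
  induction n with
  | zero => simp
  | succ n ih => rw [pow_succ]; exact ih.mul hT

theorem finite_wordLength_le (hS : Subgroup.closure (S : Set G) = ⊤) (n : ℕ) :
    {x : G | wordLength S x ≤ n}.Finite := by
  have hT : ((S : Set G) ∪ (S : Set G)⁻¹).Finite := S.finite_toSet.union S.finite_toSet.inv
  refine ((Set.finite_Iic n).biUnion fun i _ => finite_pow_of_finite hT i).subset fun x hx => ?_
  exact Set.mem_biUnion (x := wordLength S x) hx (mem_pow_wordLength hS x)

/-- A subadditive function on `G` is bounded by a multiple of the word length. -/
theorem exists_le_mul_wordLength (hS : Subgroup.closure (S : Set G) = ⊤) {N : G → ℝ}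
    (h_one : N 1 = 0) (hmul : ∀ x y, N (x * y) ≤ N x + N y) :
    ∃ M : ℝ, ∀ x, N x ≤ M * wordLength S x := by
  have hT : ((S : Set G) ∪ (S : Set G)⁻¹).Finite := S.finite_toSet.union S.finite_toSet.inv
  obtain ⟨M, hM⟩ := (hT.image N).bddAbove
  have key : ∀ n : ℕ, ∀ x ∈ ((S : Set G) ∪ (S : Set G)⁻¹) ^ n, N x ≤ M * n := by
    intro n
    induction n with
    | zero =>
      intro x hx
      rw [pow_zero, Set.mem_one] at hx
      simp [hx, h_one]
    | succ n ih =>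
      intro x hx
      rw [pow_succ] at hx
      obtain ⟨y, hy, s, hs, rfl⟩ := Set.mem_mul.mp hx
      have h1 := ih y hy
      have h2 := hM (Set.mem_image_of_mem N hs)
      push_cast
      linarith [hmul y s]
  exact ⟨M, fun x => key _ x (mem_pow_wordLength hS x)⟩

end WordLength

section ConvPow

variable {μ : G → ℝ}

theorem tsum_mul_eq_sum_support {α : Type*} {ν : α → ℝ} (hfin : (Function.support ν).Finite)
    (g : α → ℝ) : ∑' y : α, ν y * g y = ∑ y ∈ hfin.toFinset, ν y * g y :=
  tsum_eq_sum fun y hy => by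
    have : ν y = 0 := by simpa using hy
    simp [this]

theorem convPow_succ (hfin : (Function.support μ).Finite) (n : ℕ) (x : G) :
    convPow μ (n + 1) x = ∑ y ∈ hfin.toFinset, μ y * convPow μ n (y⁻¹ * x) :=
  tsum_mul_eq_sum_support hfin _

theorem convPow_nonneg (hμ : ∀ x, 0 ≤ μ x) (n : ℕ) (x : G) : 0 ≤ convPow μ n x := by
  induction n generalizing x with
  | zero => unfold convPow; split_ifs <;> simp
  | succ n ih => exact tsum_nonneg fun y => mul_nonneg (hμ y) (ih _)

theorem convPow_succ' (hfin : (Function.support μ).Finite) (n : ℕ) (x : G) :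
    convPow μ (n + 1) x = ∑ y ∈ hfin.toFinset, μ y * convPow μ n (x * y⁻¹) := by
  induction n generalizing x with
  | zero =>
    rw [convPow_succ hfin]
    refine Finset.sum_congr rfl fun y _ => ?_
    simp only [convPow, inv_mul_eq_one, mul_inv_eq_one, eq_comm (a := x)]
  | succ n ih =>
    rw [convPow_succ hfin]
    calc ∑ y ∈ hfin.toFinset, μ y * convPow μ (n + 1) (y⁻¹ * x)
        = ∑ y ∈ hfin.toFinset, ∑ z ∈ hfin.toFinset,
            μ y * (μ z * convPow μ n (y⁻¹ * x * z⁻¹)) := by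
          simp only [ih, Finset.mul_sum]
      _ = ∑ z ∈ hfin.toFinset, ∑ y ∈ hfin.toFinset,
            μ z * (μ y * convPow μ n (y⁻¹ * (x * z⁻¹))) := by
          rw [Finset.sum_comm]
          refine Finset.sum_congr rfl fun z _ => Finset.sum_congr rfl fun y _ => ?_
          rw [mul_assoc y⁻¹, mul_left_comm]
      _ = ∑ z ∈ hfin.toFinset, μ z * convPow μ (n + 1) (x * z⁻¹) := by
          simp only [convPow_succ hfin n, Finset.mul_sum]

theorem convPow_inv (hfin : (Function.support μ).Finite) (hsymm : IsSymm μ) (n : ℕ) (x : G) :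
    convPow μ n x⁻¹ = convPow μ n x := by
  induction n generalizing x with
  | zero => simp [convPow]
  | succ n ih =>
    rw [convPow_succ hfin, convPow_succ' hfin]
    refine Finset.sum_nbij' (fun y => y⁻¹) (fun y => y⁻¹) ?_ ?_ ?_ ?_ ?_
    · intro y hy; simpa [hsymm y] using hy
    · intro y hy; simpa [hsymm y] using hy
    · simp
    · simp
    · intro y _
      rw [hsymm, ← ih (x * _)]
      simp

theorem green_inv (hfin : (Function.support μ).Finite) (hsymm : IsSymm μ) (r : ℝ) (x : G) :
    green μ r x⁻¹ = green μ r x := by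
  simp only [green, convPow_inv hfin hsymm]

theorem wordLength_le_of_convPow_ne_zero {S : Finset G}
    (hS : Subgroup.closure (S : Set G) = ⊤) {k : ℕ} (hk : ∀ y, μ y ≠ 0 → wordLength S y ≤ k)
    {n : ℕ} {x : G} (hx : convPow μ n x ≠ 0) : wordLength S x ≤ k * n := by
  induction n generalizing x with
  | zero =>
    have : x = 1 := by
      by_contra h
      exact hx (if_neg h)
    simp [this, wordLength_one]
  | succ n ih =>
    have : ∃ y, μ y * convPow μ n (y⁻¹ * x) ≠ 0 := by
      by_contra! h
      exact hx ((tsum_congr h).trans tsum_zero)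
    obtain ⟨y, hy⟩ := this
    have h1 := hk y (left_ne_zero_of_mul hy)
    have h2 := ih (right_ne_zero_of_mul hy)
    have h3 := wordLength_mul_le hS y (y⁻¹ * x)
    rw [mul_inv_cancel_left] at h3
    rw [mul_add_one]
    omega

/-- The probability that the `μ`-random walk started at the identity visits `x` for the first
time at time `n`. -/
noncomputable def firstVisit (μ : G → ℝ) : ℕ → G → ℝ
  | 0 => fun x => if x = 1 then 1 else 0
  | n + 1 => fun x => if x = 1 then 0 else ∑' y : G, μ y * firstVisit μ n (y⁻¹ * x)

theorem firstVisit_one (n : ℕ) : firstVisit μ n (1 : G) = if n = 0 then 1 else 0 := by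
  cases n <;> simp [firstVisit]

theorem firstVisit_nonneg (hμ : ∀ x, 0 ≤ μ x) (n : ℕ) (x : G) : 0 ≤ firstVisit μ n x := by
  induction n generalizing x with
  | zero => unfold firstVisit; split_ifs <;> simp
  | succ n ih =>
    unfold firstVisit
    split_ifs
    exacts [le_rfl, tsum_nonneg fun y => mul_nonneg (hμ y) (ih _)]

theorem firstVisit_le_convPow (hμ : ∀ x, 0 ≤ μ x) (hfin : (Function.support μ).Finite)
    (n : ℕ) (x : G) : firstVisit μ n x ≤ convPow μ n x := by
  induction n generalizing x with
  | zero => exact le_rfl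
  | succ n ih =>
    unfold firstVisit
    split_ifs
    · exact convPow_nonneg hμ _ _
    · rw [convPow_succ hfin, tsum_mul_eq_sum_support hfin]
      exact Finset.sum_le_sum fun y _ => mul_le_mul_of_nonneg_left (ih _) (hμ y)

theorem sum_firstVisit_succ (hfin : (Function.support μ).Finite) (n : ℕ) {x : G} (hx : x ≠ 1)
    (w : G) :
    ∑ p ∈ Finset.HasAntidiagonal.antidiagonal (n + 1), firstVisit μ p.1 x * convPow μ p.2 w =
      ∑ y ∈ hfin.toFinset, μ y *
        ∑ p ∈ Finset.HasAntidiagonal.antidiagonal n, firstVisit μ p.1 (y⁻¹ * x) *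
          convPow μ p.2 w := by
  rw [Finset.Nat.sum_antidiagonal_succ]
  simp only [firstVisit, if_neg hx, zero_mul, zero_add, tsum_mul_eq_sum_support hfin,
    Finset.mul_sum, Finset.sum_mul]
  rw [Finset.sum_comm]
  simp only [mul_assoc]

theorem sum_firstVisit_one (n : ℕ) (w : G) :
    ∑ p ∈ Finset.HasAntidiagonal.antidiagonal n, firstVisit μ p.1 1 * convPow μ p.2 w =
      convPow μ n w := by
  rw [Finset.sum_eq_single (0, n)]
  · simp [firstVisit_one]
  · rintro ⟨i, j⟩ h hne
    have : i ≠ 0 := by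
      rintro rfl
      simp_all
    simp [firstVisit_one, this]
  · simp

theorem sum_firstVisit_mul_convPow_le (hμ : ∀ x, 0 ≤ μ x)
    (hfin : (Function.support μ).Finite) (n : ℕ) (x w : G) :
    ∑ p ∈ Finset.HasAntidiagonal.antidiagonal n, firstVisit μ p.1 x * convPow μ p.2 w ≤
      convPow μ n (x * w) := by
  induction n generalizing x with
  | zero =>
    by_cases hx : x = 1
    · subst hx
      rw [sum_firstVisit_one, one_mul]
    · simpa [firstVisit, hx] using convPow_nonneg hμ 0 (x * w)
  | succ n ih =>
    by_cases hx : x = 1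
    · subst hx
      rw [sum_firstVisit_one, one_mul]
    · rw [sum_firstVisit_succ hfin n hx, convPow_succ hfin]
      refine Finset.sum_le_sum fun y _ => mul_le_mul_of_nonneg_left ?_ (hμ y)
      rw [← mul_assoc]
      exact ih _

theorem sum_firstVisit_mul_convPow_one (hfin : (Function.support μ).Finite) (n : ℕ) (x : G) :
    ∑ p ∈ Finset.HasAntidiagonal.antidiagonal n, firstVisit μ p.1 x * convPow μ p.2 1 =
      convPow μ n x := by
  induction n generalizing x with
  | zero => simp [firstVisit, convPow]
  | succ n ih =>
    by_cases hx : x = 1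
    · subst hx
      rw [sum_firstVisit_one]
    · rw [sum_firstVisit_succ hfin n hx, convPow_succ hfin]
      simp only [ih]

end ConvPow

section Green

variable {μ : G → ℝ} {r : ℝ}

/-- The generating function of the first visit probabilities. -/
noncomputable def firstVisitGreen (μ : G → ℝ) (r : ℝ) (x : G) : ℝ :=
  ∑' n : ℕ, r ^ n * firstVisit μ n x

theorem summable_firstVisit (hμ : ∀ x, 0 ≤ μ x) (hfin : (Function.support μ).Finite)
    (hr : 0 ≤ r) (hsum : ∀ x : G, Summable fun n : ℕ => r ^ n * convPow μ n x) (x : G) :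
    Summable fun n : ℕ => r ^ n * firstVisit μ n x :=
  (hsum x).of_nonneg_of_le (fun n => mul_nonneg (pow_nonneg hr n) (firstVisit_nonneg hμ n x))
    fun n => mul_le_mul_of_nonneg_left (firstVisit_le_convPow hμ hfin n x) (pow_nonneg hr n)

theorem firstVisitGreen_nonneg (hμ : ∀ x, 0 ≤ μ x) (hr : 0 ≤ r) (x : G) :
    0 ≤ firstVisitGreen μ r x :=
  tsum_nonneg fun n => mul_nonneg (pow_nonneg hr n) (firstVisit_nonneg hμ n x)

theorem green_nonneg (hμ : ∀ x, 0 ≤ μ x) (hr : 0 ≤ r) (x : G) : 0 ≤ green μ r x :=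
  tsum_nonneg fun n => mul_nonneg (pow_nonneg hr n) (convPow_nonneg hμ n x)

theorem green_pos (hμ : ∀ x, 0 ≤ μ x) (hadm : IsAdmissible μ) (hr : 0 < r)
    (hsum : ∀ x : G, Summable fun n : ℕ => r ^ n * convPow μ n x) (x : G) :
    0 < green μ r x := by
  obtain ⟨n, hn⟩ := hadm x
  exact (hsum x).tsum_pos (fun n => mul_nonneg (pow_nonneg hr.le n) (convPow_nonneg hμ n x)) n
    (mul_pos (pow_pos hr n) hn)

theorem firstVisitGreen_one : firstVisitGreen μ r (1 : G) = 1 := by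
  rw [firstVisitGreen, tsum_eq_single 0 fun n hn => by simp [firstVisit_one, hn]]
  simp [firstVisit_one]

theorem firstVisitGreen_mul_green (hμ : ∀ x, 0 ≤ μ x) (hfin : (Function.support μ).Finite)
    (hr : 0 ≤ r) (hsum : ∀ x : G, Summable fun n : ℕ => r ^ n * convPow μ n x) (x w : G) :
    firstVisitGreen μ r x * green μ r w = ∑' n : ℕ, r ^ n *
      ∑ p ∈ Finset.HasAntidiagonal.antidiagonal n, firstVisit μ p.1 x * convPow μ p.2 w := by
  rw [firstVisitGreen, green, tsum_mul_tsum_eq_tsum_sum_antidiagonal_of_summable_norm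
    (summable_firstVisit hμ hfin hr hsum x).norm (hsum w).norm]
  refine tsum_congr fun n => ?_
  rw [Finset.mul_sum]
  refine Finset.sum_congr rfl fun p hp => ?_
  rw [← Finset.HasAntidiagonal.mem_antidiagonal.mp hp, pow_add]
  ring

theorem green_eq_firstVisitGreen_mul (hμ : ∀ x, 0 ≤ μ x) (hfin : (Function.support μ).Finite)
    (hr : 0 ≤ r) (hsum : ∀ x : G, Summable fun n : ℕ => r ^ n * convPow μ n x) (x : G) :
    green μ r x = firstVisitGreen μ r x * green μ r 1 := by
  rw [firstVisitGreen_mul_green hμ hfin hr hsum]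
  simp only [sum_firstVisit_mul_convPow_one hfin, green]

theorem firstVisitGreen_mul_green_le (hμ : ∀ x, 0 ≤ μ x) (hfin : (Function.support μ).Finite)
    (hr : 0 ≤ r) (hsum : ∀ x : G, Summable fun n : ℕ => r ^ n * convPow μ n x) (x w : G) :
    firstVisitGreen μ r x * green μ r w ≤ green μ r (x * w) := by
  rw [firstVisitGreen_mul_green hμ hfin hr hsum]
  have hle : ∀ n : ℕ, r ^ n *
      ∑ p ∈ Finset.HasAntidiagonal.antidiagonal n, firstVisit μ p.1 x * convPow μ p.2 w ≤
        r ^ n * convPow μ n (x * w) := fun n =>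
    mul_le_mul_of_nonneg_left (sum_firstVisit_mul_convPow_le hμ hfin n x w) (pow_nonneg hr n)
  refine ((hsum (x * w)).of_nonneg_of_le (fun n => ?_) hle).tsum_le_tsum hle (hsum _)
  exact mul_nonneg (pow_nonneg hr n) (Finset.sum_nonneg fun p _ =>
    mul_nonneg (firstVisit_nonneg hμ _ _) (convPow_nonneg hμ _ _))

theorem firstVisitGreen_eq_div (hμ : ∀ x, 0 ≤ μ x) (hfin : (Function.support μ).Finite)
    (hadm : IsAdmissible μ) (hr : 0 < r)
    (hsum : ∀ x : G, Summable fun n : ℕ => r ^ n * convPow μ n x) (x : G) :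
    firstVisitGreen μ r x = green μ r x / green μ r 1 := by
  rw [eq_div_iff (green_pos hμ hadm hr hsum 1).ne',
    green_eq_firstVisitGreen_mul hμ hfin hr.le hsum x]

theorem firstVisitGreen_pos (hμ : ∀ x, 0 ≤ μ x) (hfin : (Function.support μ).Finite)
    (hadm : IsAdmissible μ) (hr : 0 < r)
    (hsum : ∀ x : G, Summable fun n : ℕ => r ^ n * convPow μ n x) (x : G) :
    0 < firstVisitGreen μ r x := by
  rw [firstVisitGreen_eq_div hμ hfin hadm hr hsum]
  exact div_pos (green_pos hμ hadm hr hsum x) (green_pos hμ hadm hr hsum 1)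

theorem firstVisitGreen_mul_le (hμ : ∀ x, 0 ≤ μ x) (hfin : (Function.support μ).Finite)
    (hadm : IsAdmissible μ) (hr : 0 < r)
    (hsum : ∀ x : G, Summable fun n : ℕ => r ^ n * convPow μ n x) (x w : G) :
    firstVisitGreen μ r x * firstVisitGreen μ r w ≤ firstVisitGreen μ r (x * w) := by
  rw [firstVisitGreen_eq_div hμ hfin hadm hr hsum w,
    firstVisitGreen_eq_div hμ hfin hadm hr hsum (x * w), ← mul_div_assoc]
  exact div_le_div_of_nonneg_right (firstVisitGreen_mul_green_le hμ hfin hr.le hsum x w)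
    (green_pos hμ hadm hr hsum 1).le

theorem firstVisitGreen_le_one (hμ : ∀ x, 0 ≤ μ x) (hfin : (Function.support μ).Finite)
    (hsymm : IsSymm μ) (hadm : IsAdmissible μ) (hr : 0 < r)
    (hsum : ∀ x : G, Summable fun n : ℕ => r ^ n * convPow μ n x) (x : G) :
    firstVisitGreen μ r x ≤ 1 := by
  have h := firstVisitGreen_mul_le hμ hfin hadm hr hsum x x⁻¹
  have hinv : firstVisitGreen μ r x⁻¹ = firstVisitGreen μ r x := by
    simp only [firstVisitGreen_eq_div hμ hfin hadm hr hsum, green_inv hfin hsymm]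
  rw [mul_inv_cancel, firstVisitGreen_one, hinv] at h
  nlinarith [firstVisitGreen_nonneg hμ hr.le x]

/-- Visiting `x` takes at least `|x| / k` steps, so the first visit generating function gains a
factor `(r / ρ) ^ (|x| / k)` when the parameter drops from `ρ` to `r`. -/
theorem firstVisitGreen_le_rpow (hμ : ∀ x, 0 ≤ μ x) (hfin : (Function.support μ).Finite)
    (hsymm : IsSymm μ) (hadm : IsAdmissible μ) {S : Finset G}
    (hS : Subgroup.closure (S : Set G) = ⊤) {k : ℕ} (hk0 : 0 < k)
    (hk : ∀ y, μ y ≠ 0 → wordLength S y ≤ k) (hr : 0 < r) {ρ : ℝ} (hrρ : r < ρ)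
    (hsum : ∀ x : G, Summable fun n : ℕ => r ^ n * convPow μ n x)
    (hsumρ : ∀ x : G, Summable fun n : ℕ => ρ ^ n * convPow μ n x) (x : G) :
    firstVisitGreen μ r x ≤ (r / ρ) ^ ((wordLength S x : ℝ) / k) := by
  have hρ : 0 < ρ := hr.trans hrρ
  have hq : 0 < r / ρ := div_pos hr hρ
  have hk0' : (0 : ℝ) < k := by exact_mod_cast hk0
  have hle : ∀ n : ℕ, r ^ n * firstVisit μ n x ≤
      (r / ρ) ^ ((wordLength S x : ℝ) / k) * (ρ ^ n * firstVisit μ n x) := by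
    intro n
    have hf := firstVisit_nonneg hμ n x
    rcases hf.eq_or_lt with h0 | hpos
    · simp [← h0]
    have hconv : convPow μ n x ≠ 0 :=
      (hpos.trans_le (firstVisit_le_convPow hμ hfin n x)).ne'
    have hlen : (wordLength S x : ℝ) ≤ k * n := by
      exact_mod_cast wordLength_le_of_convPow_ne_zero hS hk hconv
    have hpow : (r / ρ) ^ n ≤ (r / ρ) ^ ((wordLength S x : ℝ) / k) := by
      rw [← Real.rpow_natCast]
      refine Real.rpow_le_rpow_of_exponent_ge hq ((div_le_one hρ).mpr hrρ.le) ?_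
      rw [div_le_iff₀ hk0']
      linarith
    calc r ^ n * firstVisit μ n x = (r / ρ) ^ n * (ρ ^ n * firstVisit μ n x) := by
          rw [div_pow]
          field_simp
      _ ≤ _ := mul_le_mul_of_nonneg_right hpow (mul_nonneg (pow_nonneg hρ.le n) hf)
  calc firstVisitGreen μ r x
      ≤ ∑' n : ℕ, (r / ρ) ^ ((wordLength S x : ℝ) / k) * (ρ ^ n * firstVisit μ n x) :=
        (summable_firstVisit hμ hfin hr.le hsum x).tsum_le_tsum hle
          ((summable_firstVisit hμ hfin hρ.le hsumρ x).mul_left _)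
    _ = (r / ρ) ^ ((wordLength S x : ℝ) / k) * firstVisitGreen μ ρ x := tsum_mul_left
    _ ≤ _ := mul_le_of_le_one_right (Real.rpow_nonneg hq.le _)
        (firstVisitGreen_le_one hμ hfin hsymm hadm hρ hsumρ x)

theorem greenNorm_eq_neg_log (hμ : ∀ x, 0 ≤ μ x) (hfin : (Function.support μ).Finite)
    (hadm : IsAdmissible μ) (hr : 0 < r)
    (hsum : ∀ x : G, Summable fun n : ℕ => r ^ n * convPow μ n x) (x : G) :
    greenNorm μ r x = -Real.log (firstVisitGreen μ r x) := by
  rw [greenNorm, firstVisitGreen_eq_div hμ hfin hadm hr hsum]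

theorem greenNorm_inv (hfin : (Function.support μ).Finite) (hsymm : IsSymm μ) (x : G) :
    greenNorm μ r x⁻¹ = greenNorm μ r x := by
  rw [greenNorm, greenNorm, green_inv hfin hsymm]

theorem greenNorm_one (hμ : ∀ x, 0 ≤ μ x) (hfin : (Function.support μ).Finite)
    (hadm : IsAdmissible μ) (hr : 0 < r)
    (hsum : ∀ x : G, Summable fun n : ℕ => r ^ n * convPow μ n x) :
    greenNorm μ r (1 : G) = 0 := by
  simp [greenNorm_eq_neg_log hμ hfin hadm hr hsum, firstVisitGreen_one]

theorem greenNorm_mul_le (hμ : ∀ x, 0 ≤ μ x) (hfin : (Function.support μ).Finite)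
    (hadm : IsAdmissible μ) (hr : 0 < r)
    (hsum : ∀ x : G, Summable fun n : ℕ => r ^ n * convPow μ n x) (x w : G) :
    greenNorm μ r (x * w) ≤ greenNorm μ r x + greenNorm μ r w := by
  have hpos := firstVisitGreen_pos hμ hfin hadm hr hsum
  simp only [greenNorm_eq_neg_log hμ hfin hadm hr hsum]
  have h := Real.log_le_log (mul_pos (hpos x) (hpos w))
    (firstVisitGreen_mul_le hμ hfin hadm hr hsum x w)
  rw [Real.log_mul (hpos x).ne' (hpos w).ne'] at h
  linarith

theorem exists_mul_wordLength_le_greenNorm (hμ : ∀ x, 0 ≤ μ x)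
    (hfin : (Function.support μ).Finite) (hsymm : IsSymm μ) (hadm : IsAdmissible μ)
    {S : Finset G} (hS : Subgroup.closure (S : Set G) = ⊤) {k : ℕ} (hk0 : 0 < k)
    (hk : ∀ y, μ y ≠ 0 → wordLength S y ≤ k) (hr : 0 < r) {ρ : ℝ} (hrρ : r < ρ)
    (hsum : ∀ x : G, Summable fun n : ℕ => r ^ n * convPow μ n x)
    (hsumρ : ∀ x : G, Summable fun n : ℕ => ρ ^ n * convPow μ n x) :
    ∃ c : ℝ, 0 < c ∧ ∀ x, c * wordLength S x ≤ greenNorm μ r x := by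
  have hρ : 0 < ρ := hr.trans hrρ
  have hlog : Real.log (r / ρ) < 0 := Real.log_neg (div_pos hr hρ) ((div_lt_one hρ).mpr hrρ)
  refine ⟨-Real.log (r / ρ) / k, div_pos (neg_pos.mpr hlog) (by exact_mod_cast hk0),
    fun x => ?_⟩
  have h := Real.log_le_log (firstVisitGreen_pos hμ hfin hadm hr hsum x)
    (firstVisitGreen_le_rpow hμ hfin hsymm hadm hS hk0 hk hr hrρ hsum hsumρ x)
  rw [Real.log_rpow (div_pos hr hρ)] at h
  rw [greenNorm_eq_neg_log hμ hfin hadm hr hsum]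
  calc -Real.log (r / ρ) / k * wordLength S x
      = -((wordLength S x : ℝ) / k * Real.log (r / ρ)) := by ring
    _ ≤ _ := neg_le_neg h

theorem green_eq_add_sum (hfin : (Function.support μ).Finite)
    (hsum : ∀ x : G, Summable fun n : ℕ => r ^ n * convPow μ n x) (x : G) :
    green μ r x = (if x = 1 then 1 else 0) +
      r * ∑ y ∈ hfin.toFinset, μ y * green μ r (y⁻¹ * x) := by
  rw [green, (hsum x).tsum_eq_zero_add, pow_zero, one_mul]
  congr 1
  simp only [green, ← tsum_mul_left, convPow_succ hfin]
  rw [← Summable.tsum_finsetSum fun y _ => (hsum _).mul_left _, ← tsum_mul_left]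
  refine tsum_congr fun n => ?_
  rw [Finset.mul_sum, Finset.mul_sum]
  exact Finset.sum_congr rfl fun y _ => by ring

theorem greenSphereSum_nonneg (hμ : ∀ x, 0 ≤ μ x) (hr : 0 ≤ r) (S : Finset G) (n : ℕ) :
    0 ≤ greenSphereSum S μ r n :=
  tsum_nonneg fun x => by split_ifs <;> simp [green_nonneg hμ hr]

theorem sum_greenSphereSum {S : Finset G} (hS : Subgroup.closure (S : Set G) = ⊤) (n : ℕ) :
    ∑ i ∈ Finset.range (n + 1), greenSphereSum S μ r i =
      ∑ x ∈ (finite_wordLength_le hS n).toFinset, green μ r x := by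
  have hsphere : ∀ i ∈ Finset.range (n + 1), greenSphereSum S μ r i =
      ∑ x ∈ (finite_wordLength_le hS n).toFinset,
        if wordLength S x = i then green μ r x else 0 := fun i hi =>
    tsum_eq_sum fun x hx => if_neg fun h => by
      simp at hx hi
      omega
  rw [Finset.sum_congr rfl hsphere, Finset.sum_comm]
  refine Finset.sum_congr rfl fun x hx => ?_
  rw [Finset.sum_ite_eq, if_pos]
  simp at hx ⊢
  omega

/-- Every trajectory leaving a ball must cross the surrounding annulus of width `k`, so the
Green function has mass at least one there. -/
theorem sum_greenSphereSum_add_one_le (hprob : IsProbMeasure μ)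
    (hfin : (Function.support μ).Finite) {S : Finset G}
    (hS : Subgroup.closure (S : Set G) = ⊤) {k : ℕ} (hk : ∀ y, μ y ≠ 0 → wordLength S y ≤ k)
    (hr : 1 ≤ r) (hsum : ∀ x : G, Summable fun n : ℕ => r ^ n * convPow μ n x) (n : ℕ) :
    ∑ i ∈ Finset.range (n + 1), greenSphereSum S μ r i + 1 ≤
      ∑ i ∈ Finset.range (n + k + 1), greenSphereSum S μ r i := by
  have hr0 : 0 ≤ r := zero_le_one.trans hr
  rw [sum_greenSphereSum hS, sum_greenSphereSum hS]
  set A := (finite_wordLength_le hS n).toFinset with hA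
  set B := (finite_wordLength_le hS (n + k)).toFinset with hB
  have hmass : ∑ y ∈ hfin.toFinset, μ y = 1 := by
    have h := tsum_mul_eq_sum_support hfin fun _ => 1
    simp only [mul_one] at h
    rw [← h, hprob.2.tsum_eq]
  have hA0 : 0 ≤ ∑ x ∈ A, green μ r x :=
    Finset.sum_nonneg fun x _ => green_nonneg hprob.1 hr0 x
  have hshift : ∀ y ∈ hfin.toFinset,
      ∑ x ∈ A, green μ r x ≤ ∑ x ∈ B, green μ r (y⁻¹ * x) := by
    intro y hy
    have hyk : wordLength S y ≤ k := hk y (by simpa using hy)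
    calc ∑ x ∈ A, green μ r x = ∑ x ∈ A.image (y * ·), green μ r (y⁻¹ * x) := by
          rw [Finset.sum_image fun a _ b _ h => mul_left_cancel h]
          simp
      _ ≤ _ := by
          refine Finset.sum_le_sum_of_subset_of_nonneg (fun z hz => ?_)
            fun x _ _ => green_nonneg hprob.1 hr0 _
          obtain ⟨x, hx, rfl⟩ := Finset.mem_image.mp hz
          have h := wordLength_mul_le hS y x
          simp [hA, hB] at hx ⊢
          omega
  have hone : (1 : G) ∈ B := by simp [hB, wordLength_one]
  calc ∑ x ∈ A, green μ r x + 1 ≤ 1 + r * ∑ x ∈ A, green μ r x := by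
        nlinarith
    _ = 1 + r * ∑ y ∈ hfin.toFinset, μ y * ∑ x ∈ A, green μ r x := by
        rw [← Finset.sum_mul, hmass, one_mul]
    _ ≤ 1 + r * ∑ y ∈ hfin.toFinset, μ y * ∑ x ∈ B, green μ r (y⁻¹ * x) := by
        gcongr with y hy
        · exact hprob.1 y
        · exact hshift y hy
    _ = ∑ x ∈ B, green μ r x := by
        rw [Finset.sum_congr rfl fun x _ => green_eq_add_sum hfin hsum x,
          Finset.sum_add_distrib, Finset.sum_ite_eq', if_pos hone, ← Finset.mul_sum]
        simp only [Finset.mul_sum]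
        rw [Finset.sum_comm]

theorem greenGrowthRate_nonneg (hprob : IsProbMeasure μ)
    (hfin : (Function.support μ).Finite) {S : Finset G}
    (hS : Subgroup.closure (S : Set G) = ⊤) {k : ℕ} (hk : ∀ y, μ y ≠ 0 → wordLength S y ≤ k)
    (hr : 1 ≤ r) (hsum : ∀ x : G, Summable fun n : ℕ => r ^ n * convPow μ n x) :
    0 ≤ greenGrowthRate S μ r := by
  have hH := greenSphereSum_nonneg hprob.1 (zero_le_one.trans hr) S
  rw [greenGrowthRate, limsup_eq]
  refine Real.sInf_nonneg fun a ha => ?_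
  by_contra! ha0
  have hbound : ∀ᶠ n : ℕ in atTop, ‖greenSphereSum S μ r n‖ ≤ Real.exp a ^ n := by
    filter_upwards [ha, eventually_gt_atTop 0] with n hn hn0
    rw [Real.norm_of_nonneg (hH n), ← Real.exp_nat_mul]
    rcases (hH n).eq_or_lt with h0 | hpos
    · rw [← h0]
      exact (Real.exp_pos _).le
    · rw [div_le_iff₀ (by exact_mod_cast hn0)] at hn
      rw [← Real.log_le_iff_le_exp hpos, mul_comm]
      exact hn
  have hsummable : Summable (greenSphereSum S μ r) :=
    (summable_geometric_of_lt_one (Real.exp_pos a).le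
      (Real.exp_lt_one_iff.mpr ha0)).of_norm_bounded_eventually_nat hbound
  have hgrow : ∀ m : ℕ, (m : ℝ) ≤ ∑ i ∈ Finset.range (m * k + 1), greenSphereSum S μ r i := by
    intro m
    induction m with
    | zero => exact_mod_cast Finset.sum_nonneg fun i _ => hH i
    | succ m ih =>
      have h := sum_greenSphereSum_add_one_le hprob hfin hS hk hr hsum (m * k)
      rw [← Nat.succ_mul] at h
      push_cast
      linarith
  obtain ⟨m, hm⟩ := exists_nat_gt (∑' n, greenSphereSum S μ r n)
  linarith [hgrow m, hsummable.sum_le_tsum (Finset.range (m * k + 1)) fun i _ => hH i]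

end Green

end GreenGrowth

namespace GreenGrowth

/-- For `1 ≤ r < R`, the function
`𝔡_r(x,y) = ω_Γ(r)|x⁻¹y| + |x⁻¹y|_r` is a proper metric on `Γ` which is
quasi-isometric to the word metric. -/
theorem drDist_proper_metric_quasi_isometric {G : Type*} [Group G] [Infinite G]
    (S : Finset G) (hS : Subgroup.closure (S : Set G) = ⊤) (μ : G → ℝ)
    (hprob : IsProbMeasure μ) (hsymm : IsSymm μ) (hadm : IsAdmissible μ)
    (hfin : (Function.support μ).Finite) (htrans : TransientAtSpectralRadius μ)
    (r : ℝ) (hr1 : 1 ≤ r) (hrR : r < greenRadius μ) :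
    (∀ x y : G, drDist S μ r x y = drDist S μ r y x) ∧
    (∀ x y : G, 0 ≤ drDist S μ r x y) ∧
    (∀ x y : G, drDist S μ r x y = 0 ↔ x = y) ∧
    (∀ x y z : G, drDist S μ r x z ≤ drDist S μ r x y + drDist S μ r y z) ∧
    (∀ c : ℝ, {x : G | drDist S μ r 1 x ≤ c}.Finite) ∧
    (∃ L : ℝ, 1 ≤ L ∧ ∃ C : ℝ, 0 ≤ C ∧ ∀ x y : G,
      (wordLength S (x⁻¹ * y) : ℝ) / L - C ≤ drDist S μ r x y ∧
        drDist S μ r x y ≤ L * (wordLength S (x⁻¹ * y) : ℝ) + C) := by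
  have hμ := hprob.1
  have hr0 : 0 < r := zero_lt_one.trans_le hr1
  have hsum := htrans r hr0 hrR.le
  have hsumR := htrans _ (hr0.trans hrR) le_rfl
  obtain ⟨k, hk0, hk⟩ : ∃ k : ℕ, 0 < k ∧ ∀ y, μ y ≠ 0 → wordLength S y ≤ k := by
    obtain ⟨k, hk⟩ := (hfin.image (wordLength S)).bddAbove
    exact ⟨k + 1, k.succ_pos, fun y hy => (hk (Set.mem_image_of_mem _ hy)).trans k.le_succ⟩
  obtain ⟨c, hc0, hc⟩ := exists_mul_wordLength_le_greenNorm hμ hfin hsymm hadm hS hk0 hk hr0 hrR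
    hsum hsumR
  obtain ⟨M, hM⟩ := exists_le_mul_wordLength hS (greenNorm_one hμ hfin hadm hr0 hsum)
    (greenNorm_mul_le hμ hfin hadm hr0 hsum)
  have hω := greenGrowthRate_nonneg hprob hfin hS hk hr1 hsum
  have hlower : ∀ x y : G, c * wordLength S (x⁻¹ * y) ≤ drDist S μ r x y := fun x y => by
    have := mul_nonneg hω (Nat.cast_nonneg (α := ℝ) (wordLength S (x⁻¹ * y)))
    rw [drDist]
    linarith [hc (x⁻¹ * y)]
  refine ⟨fun x y => ?_, fun x y => ?_, fun x y => ⟨fun h => ?_, ?_⟩, fun x y z => ?_,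
    fun b => ?_, ?_⟩
  · rw [drDist, drDist, ← wordLength_inv hS (x⁻¹ * y), ← greenNorm_inv hfin hsymm (x⁻¹ * y),
      mul_inv_rev, inv_inv]
  · exact (by positivity : (0 : ℝ) ≤ c * wordLength S (x⁻¹ * y)).trans (hlower x y)
  · have hle := hlower x y
    rw [h] at hle
    have hzero : (wordLength S (x⁻¹ * y) : ℝ) ≤ 0 := by
      by_contra! hpos
      exact absurd hle (not_le.mpr (mul_pos hc0 hpos))
    have : wordLength S (x⁻¹ * y) = 0 := Nat.le_zero.mp (by exact_mod_cast hzero)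
    exact inv_mul_eq_one.mp ((wordLength_eq_zero_iff hS).mp this)
  · rintro rfl
    simp [drDist, wordLength_one, greenNorm_one hμ hfin hadm hr0 hsum]
  · have hxz : x⁻¹ * z = x⁻¹ * y * (y⁻¹ * z) := by group
    have hword : (wordLength S (x⁻¹ * z) : ℝ) ≤
        wordLength S (x⁻¹ * y) + wordLength S (y⁻¹ * z) := by
      rw [hxz]
      exact_mod_cast wordLength_mul_le hS _ _
    have hgreen := greenNorm_mul_le hμ hfin hadm hr0 hsum (x⁻¹ * y) (y⁻¹ * z)
    rw [← hxz] at hgreen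
    have := mul_le_mul_of_nonneg_left hword hω
    simp only [drDist]
    linarith
  · refine (finite_wordLength_le hS ⌊b / c⌋₊).subset fun x hx => ?_
    have h := (hlower 1 x).trans hx
    rw [inv_one, one_mul] at h
    refine Nat.le_floor ?_
    rw [le_div_iff₀ hc0]
    linarith
  · refine ⟨max 1 (max c⁻¹ (greenGrowthRate S μ r + M)), le_max_left _ _, 0, le_rfl,
      fun x y => ⟨?_, ?_⟩⟩
    · refine le_trans ?_ (hlower x y)
      have hL : c⁻¹ ≤ max 1 (max c⁻¹ (greenGrowthRate S μ r + M)) :=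
        (le_max_left _ _).trans (le_max_right _ _)
      rw [sub_zero, div_eq_inv_mul]
      refine mul_le_mul_of_nonneg_right ?_ (Nat.cast_nonneg _)
      exact inv_le_of_inv_le₀ hc0 hL
    · have hL : greenGrowthRate S μ r + M ≤ max 1 (max c⁻¹ (greenGrowthRate S μ r + M)) :=
        (le_max_right _ _).trans (le_max_right _ _)
      have := mul_le_mul_of_nonneg_right hL (Nat.cast_nonneg (α := ℝ) (wordLength S (x⁻¹ * y)))
      rw [drDist]
      linarith [hM (x⁻¹ * y)]

end GreenGrowth
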